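/- arXiv:1906.09376 — 2 statements merged into one kernel-verified Lean document; each statement's English description precedes it below -/
import Mathlib

section
/- Let ρ_BC be a bipartite density matrix saturating the Araki–Lieb inequality, i.e. S(ρ_BC) + S(ρ_C) − S(ρ_B) = 0. Then for every decomposition ρ_BC = ∑_i q_i ρ^i_BC with q_i > 0 and ρ^i_BC density matrices, each component has the same marginal on C: Tr_B ρ^i_BC = ρ_C for all i. -/
open Matrix Kronecker ComplexOrder

/-- Von Neumann entropy `S(ρ) = -Tr(ρ ln ρ)`, computed via eigenvalues. -/
noncomputable def vN {n : Type} [Fintype n] [DecidableEq n] (ρ : Matrix n n ℂ) : ℝ :=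
  if h : ρ.IsHermitian then -∑ i, h.eigenvalues i * Real.log (h.eigenvalues i) else 0

/-- A density matrix: positive semidefinite with unit trace. -/
def IsDensity {n : Type} [Fintype n] (ρ : Matrix n n ℂ) : Prop :=
  ρ.PosSemidef ∧ ρ.trace = 1

/-- Partial trace over the left tensor factor. -/
noncomputable def ptraceLeft {a b : Type} [Fintype a] [Fintype b]
    (M : Matrix (a × b) (a × b) ℂ) : Matrix b b ℂ :=
  Matrix.of fun i j => ∑ k, M (k, i) (k, j)

/-- Partial trace over the right tensor factor. -/
noncomputable def ptraceRight {a b : Type} [Fintype a] [Fintype b]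
    (M : Matrix (a × b) (a × b) ℂ) : Matrix a a ℂ :=
  Matrix.of fun i j => ∑ k, M (i, k) (j, k)

lemma vN_eq_roots {n : Type} [Fintype n] [DecidableEq n] {A : Matrix n n ℂ} (h : A.IsHermitian) :
    vN A = -(A.charpoly.roots.map (fun z => z.re * Real.log z.re)).sum := by
  rw [vN, dif_pos h, h.roots_charpoly_eq_eigenvalues, Multiset.map_map]
  simp

lemma vN_mul_comm {m n : Type} [Fintype n] [DecidableEq n] [Fintype m] [DecidableEq m]
    (Z : Matrix m n ℂ) : vN (Z * Zᴴ) = vN (Zᴴ * Z) := by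
  rw [vN_eq_roots (isHermitian_mul_conjTranspose_self Z),
    vN_eq_roots (isHermitian_conjTranspose_mul_self Z)]
  have h := congrArg Polynomial.roots (Matrix.charpoly_mul_comm' Z Zᴴ)
  rw [Polynomial.roots_mul
      (mul_ne_zero (pow_ne_zero _ Polynomial.X_ne_zero) (Matrix.charpoly_monic _).ne_zero),
    Polynomial.roots_mul
      (mul_ne_zero (pow_ne_zero _ Polynomial.X_ne_zero) (Matrix.charpoly_monic _).ne_zero),
    Polynomial.roots_X_pow, Polynomial.roots_X_pow] at h
  have h2 := congrArg (fun s : Multiset ℂ => (s.map (fun z => z.re * Real.log z.re)).sum) h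
  simp [Multiset.map_nsmul, Multiset.sum_nsmul] at h2
  rw [h2]

lemma vN_transpose {n : Type} [Fintype n] [DecidableEq n] {A : Matrix n n ℂ}
    (h : A.IsHermitian) : vN Aᵀ = vN A := by
  rw [vN_eq_roots h, vN_eq_roots h.transpose, Matrix.charpoly_transpose]

lemma spec_exists {n : Type} [Fintype n] [DecidableEq n] {A : Matrix n n ℂ} (h : A.PosSemidef) :
    ∃ (U : Matrix n n ℂ) (l : n → ℝ), U * Uᴴ = 1 ∧ Uᴴ * U = 1 ∧ (∀ i, 0 ≤ l i) ∧
      A = U * diagonal (fun i => (l i : ℂ)) * Uᴴ ∧ A.trace = ((∑ i, l i : ℝ) : ℂ) ∧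
      vN A = -∑ i, l i * Real.log (l i) := by
  have hH := h.isHermitian
  refine ⟨hH.eigenvectorUnitary, hH.eigenvalues, ?_, ?_, h.eigenvalues_nonneg, ?_, ?_, ?_⟩
  · exact Unitary.coe_mul_star_self _
  · exact Unitary.coe_star_mul_self _
  · exact hH.spectral_theorem
  · rw [hH.trace_eq_sum_eigenvalues]; simp
  · rw [vN, dif_pos hH]

lemma scalar_klein {x y : ℝ} (hx : 0 ≤ x) (hy : 0 ≤ y) (hxy : y = 0 → x = 0) :
    0 ≤ x * Real.log x - x * Real.log y - x + y ∧
      (x * Real.log x - x * Real.log y - x + y = 0 → x = y) := by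
  rcases hx.eq_or_lt with rfl | hx
  · simp only [zero_mul, sub_zero, zero_add]
    exact ⟨hy, fun h => h.symm⟩
  · have hy : 0 < y := lt_of_le_of_ne hy (fun h => hx.ne' (hxy h.symm))
    have e : x * Real.log x - x * Real.log y - x + y = x * (y / x - 1 - Real.log (y / x)) := by
      rw [Real.log_div hy.ne' hx.ne']; field_simp; ring
    rw [e]
    refine ⟨mul_nonneg hx.le (by linarith [Real.log_le_sub_one_of_pos (div_pos hy hx)]), ?_⟩
    intro h
    by_contra hne
    have h1 : y / x ≠ 1 := fun h => hne ((div_eq_one_iff_eq hx.ne').1 h).symm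
    have := mul_pos hx (sub_pos.2 (Real.log_lt_sub_one_of_pos (div_pos hy hx) h1))
    linarith

/-- Equality case of Klein's inequality, in a form adapted to our use. -/
lemma klein_eq {n : Type} [Fintype n] [DecidableEq n] {σ W : Matrix n n ℂ} (hσ : IsDensity σ)
    (hW1 : W * Wᴴ = 1) (hW2 : Wᴴ * W = 1) (μ : n → ℝ) (hμ : ∀ j, 0 ≤ μ j) (hμ1 : ∑ j, μ j = 1)
    (h0 : ∀ j, μ j = 0 → (Wᴴ * σ * W) j j = 0)
    (hS : vN σ = -∑ j, ((Wᴴ * σ * W) j j).re * Real.log (μ j)) :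
    σ = W * diagonal (fun i => (μ i : ℂ)) * Wᴴ := by
  obtain ⟨U, l, hU1, hU2, hl, hA, htr, hv⟩ := spec_exists hσ.1
  have hl1 : ∑ i, l i = 1 := by
    have := hσ.2; rw [htr] at this; exact_mod_cast this
  set V := Uᴴ * W with hV
  have hV1 : V * Vᴴ = 1 := by
    rw [hV, conjTranspose_mul, conjTranspose_conjTranspose]
    calc Uᴴ * W * (Wᴴ * U) = Uᴴ * (W * Wᴴ) * U := by simp only [Matrix.mul_assoc]
      _ = 1 := by rw [hW1, Matrix.mul_one, hU2]
  have hV2 : Vᴴ * V = 1 := by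
    rw [hV, conjTranspose_mul, conjTranspose_conjTranspose]
    calc Wᴴ * U * (Uᴴ * W) = Wᴴ * (U * Uᴴ) * W := by simp only [Matrix.mul_assoc]
      _ = 1 := by rw [hU1, Matrix.mul_one, hW2]
  have hd : Wᴴ * σ * W = Vᴴ * diagonal (fun i => (l i : ℂ)) * V := by
    rw [hA, hV, conjTranspose_mul, conjTranspose_conjTranspose]
    simp only [Matrix.mul_assoc]
  set P : n → n → ℝ := fun k j => Complex.normSq (V k j) with hP
  have hPn : ∀ k j, 0 ≤ P k j := fun k j => Complex.normSq_nonneg _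
  have hdj : ∀ j, (Wᴴ * σ * W) j j = ((∑ k, l k * P k j : ℝ) : ℂ) := by
    intro j
    rw [hd, Matrix.mul_apply]
    push_cast
    refine Finset.sum_congr rfl fun k _ => ?_
    rw [Matrix.mul_diagonal, conjTranspose_apply, hP]
    simp only [Complex.normSq_eq_conj_mul_self]
    simp only [RCLike.star_def]
    ring
  have hrow : ∀ k, ∑ j, P k j = 1 := by
    intro k
    have := congrFun (congrFun hV1 k) k
    rw [Matrix.mul_apply, one_apply_eq] at this
    have h2 : ((∑ j, P k j : ℝ) : ℂ) = 1 := by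
      rw [← this]; push_cast
      refine Finset.sum_congr rfl fun j _ => ?_
      simp only [hP, Complex.normSq_eq_conj_mul_self, conjTranspose_apply, RCLike.star_def]
      ring
    exact_mod_cast h2
  have hcol : ∀ j, ∑ k, P k j = 1 := by
    intro j
    have := congrFun (congrFun hV2 j) j
    rw [Matrix.mul_apply, one_apply_eq] at this
    have h2 : ((∑ k, P k j : ℝ) : ℂ) = 1 := by
      rw [← this]; push_cast
      refine Finset.sum_congr rfl fun k _ => ?_
      simp only [hP, Complex.normSq_eq_conj_mul_self, conjTranspose_apply, RCLike.star_def]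
    exact_mod_cast h2
  have hz : ∀ k j, μ j = 0 → P k j ≠ 0 → l k = 0 := by
    intro k j hj hne
    have h1 := h0 j hj
    rw [hdj] at h1
    have h2 : ∑ k, l k * P k j = 0 := by exact_mod_cast h1
    have := (Finset.sum_eq_zero_iff_of_nonneg
      (fun k _ => mul_nonneg (hl k) (hPn k j))).1 h2 k (Finset.mem_univ _)
    exact (mul_eq_zero.1 this).resolve_right hne
  set T : n → n → ℝ := fun k j =>
    P k j * (l k * Real.log (l k) - l k * Real.log (μ j) - l k + μ j) with hT
  have hTn : ∀ k j, 0 ≤ T k j := by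
    intro k j
    by_cases hne : P k j = 0
    · simp [hT, hne]
    · exact mul_nonneg (hPn k j) (scalar_klein (hl k) (hμ j) (fun h => hz k j h hne)).1
  have hTs : ∑ k, ∑ j, T k j = 0 := by
    have e1 : ∑ k, ∑ j, P k j * (l k * Real.log (l k)) = ∑ k, l k * Real.log (l k) := by
      simp_rw [← Finset.sum_mul, hrow, one_mul]
    have e2 : ∑ k, ∑ j, P k j * l k = 1 := by
      simp_rw [← Finset.sum_mul, hrow, one_mul, hl1]
    have e3 : ∑ k, ∑ j, P k j * μ j = 1 := by
      rw [Finset.sum_comm]; simp_rw [← Finset.sum_mul, hcol, one_mul, hμ1]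
    have e4 : ∑ k, ∑ j, P k j * (l k * Real.log (μ j)) = ∑ k, l k * Real.log (l k) := by
      rw [Finset.sum_comm]
      have : ∑ j, ((Wᴴ * σ * W) j j).re * Real.log (μ j) = ∑ k, l k * Real.log (l k) := by
        linarith
      rw [← this]
      refine Finset.sum_congr rfl fun j _ => ?_
      rw [hdj, Complex.ofReal_re, Finset.sum_mul]
      refine Finset.sum_congr rfl fun k _ => ?_
      ring
    simp only [hT, mul_add, mul_sub, Finset.sum_add_distrib, Finset.sum_sub_distrib]
    rw [e1, e2, e3, e4]; ring
  have key : ∀ k j, V k j ≠ 0 → l k = μ j := by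
    intro k j hne
    have hPne : P k j ≠ 0 := by simpa [hP, Complex.normSq_eq_zero] using hne
    have h1 := (Finset.sum_eq_zero_iff_of_nonneg
      (fun k _ => Finset.sum_nonneg fun j _ => hTn k j)).1 hTs k (Finset.mem_univ _)
    have h2 := (Finset.sum_eq_zero_iff_of_nonneg (fun j _ => hTn k j)).1 h1 j (Finset.mem_univ _)
    exact (scalar_klein (hl k) (hμ j) (fun h => hz k j h hPne)).2
      ((mul_eq_zero.1 h2).resolve_left hPne)
  have hcomm : diagonal (fun i => (l i : ℂ)) * V = V * diagonal (fun i => (μ i : ℂ)) := by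
    ext k j
    rw [diagonal_mul, mul_diagonal]
    by_cases h : V k j = 0
    · simp [h]
    · rw [key k j h, mul_comm]
  have hUV : U * V = W := by rw [hV, ← Matrix.mul_assoc, hU1, Matrix.one_mul]
  have hUW : Uᴴ = V * Wᴴ := by rw [hV, Matrix.mul_assoc, hW1, Matrix.mul_one]
  calc σ = U * diagonal (fun i => (l i : ℂ)) * Uᴴ := hA
    _ = U * (diagonal (fun i => (l i : ℂ)) * V) * Wᴴ := by rw [hUW]; simp only [Matrix.mul_assoc]
    _ = U * V * diagonal (fun i => (μ i : ℂ)) * Wᴴ := by rw [hcomm]; simp only [Matrix.mul_assoc]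
    _ = _ := by rw [hUV]

lemma ptraceRight_conj {a c : Type} [Fintype a] [DecidableEq a] [Fintype c] [DecidableEq c]
    (M : Matrix (a × c) (a × c) ℂ) (U : Matrix a a ℂ) (V : Matrix c c ℂ) (hV : V * Vᴴ = 1) :
    ptraceRight ((U ⊗ₖ V)ᴴ * M * (U ⊗ₖ V)) = Uᴴ * ptraceRight M * U := by
  have L1 : ∀ (X Y : Matrix a a ℂ) (N : Matrix (a × c) (a × c) ℂ),
      ptraceRight ((X ⊗ₖ (1 : Matrix c c ℂ)) * N * (Y ⊗ₖ (1 : Matrix c c ℂ)))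
        = X * ptraceRight N * Y := by
    intro X Y N
    ext i j
    simp only [ptraceRight, Matrix.mul_apply, Fintype.sum_prod_type, kroneckerMap_apply, one_apply,
      of_apply, mul_ite, mul_one, mul_zero, ite_mul, zero_mul, Finset.sum_ite_eq,
      Finset.sum_ite_eq', Finset.mem_univ, if_true, Finset.sum_mul, Finset.mul_sum]
    rw [Finset.sum_comm]
    refine Finset.sum_congr rfl fun x _ => ?_
    rw [Finset.sum_comm]
  have L2 : ∀ (D : Matrix c c ℂ) (N : Matrix (a × c) (a × c) ℂ),
      ptraceRight (N * ((1 : Matrix a a ℂ) ⊗ₖ D)) = ptraceRight (((1 : Matrix a a ℂ) ⊗ₖ D) * N) := by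
    intro D N
    ext i j
    simp only [ptraceRight, Matrix.mul_apply, Fintype.sum_prod_type, kroneckerMap_apply, one_apply,
      of_apply, mul_ite, mul_one, mul_zero, ite_mul, zero_mul, one_mul, Finset.sum_ite_irrel,
      Finset.sum_const_zero, Finset.sum_ite_eq,
      Finset.sum_ite_eq', Finset.mem_univ, if_true]
    rw [Finset.sum_comm]
    refine Finset.sum_congr rfl fun x _ => Finset.sum_congr rfl fun y _ => ?_
    ring
  have hk : U ⊗ₖ V = ((1 : Matrix a a ℂ) ⊗ₖ V) * (U ⊗ₖ (1 : Matrix c c ℂ)) := by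
    rw [← mul_kronecker_mul, Matrix.one_mul, Matrix.mul_one]
  have hk2 : (U ⊗ₖ V)ᴴ = (Uᴴ ⊗ₖ (1 : Matrix c c ℂ)) * ((1 : Matrix a a ℂ) ⊗ₖ Vᴴ) := by
    rw [← mul_kronecker_mul, Matrix.one_mul, Matrix.mul_one, conjTranspose_kronecker]
  rw [hk2, hk]
  have : (Uᴴ ⊗ₖ (1 : Matrix c c ℂ)) * ((1 : Matrix a a ℂ) ⊗ₖ Vᴴ) * M *
      (((1 : Matrix a a ℂ) ⊗ₖ V) * (U ⊗ₖ (1 : Matrix c c ℂ))) =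
      (Uᴴ ⊗ₖ (1 : Matrix c c ℂ)) * (((1 : Matrix a a ℂ) ⊗ₖ Vᴴ) * M *
      ((1 : Matrix a a ℂ) ⊗ₖ V)) * (U ⊗ₖ (1 : Matrix c c ℂ)) := by
    simp only [Matrix.mul_assoc]
  rw [this, L1, L2, ← Matrix.mul_assoc, ← mul_kronecker_mul, hV, Matrix.one_mul, one_kronecker_one,
    Matrix.one_mul]

lemma ptraceLeft_eq_swap {a c : Type} [Fintype a] [Fintype c] (M : Matrix (a × c) (a × c) ℂ) :
    ptraceLeft M = ptraceRight (M.submatrix Prod.swap Prod.swap : Matrix (c × a) (c × a) ℂ) := rfl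

lemma ptraceLeft_conj {a c : Type} [Fintype a] [DecidableEq a] [Fintype c] [DecidableEq c]
    (M : Matrix (a × c) (a × c) ℂ) (U : Matrix a a ℂ) (V : Matrix c c ℂ) (hU : U * Uᴴ = 1) :
    ptraceLeft ((U ⊗ₖ V)ᴴ * M * (U ⊗ₖ V)) = Vᴴ * ptraceLeft M * V := by
  have hs : (V ⊗ₖ U) = (U ⊗ₖ V).submatrix (Equiv.prodComm c a) (Equiv.prodComm c a) := by
    ext ⟨i, j⟩ ⟨k, l⟩; simp [mul_comm]
  have := ptraceRight_conj (M.submatrix (Equiv.prodComm c a) (Equiv.prodComm c a)) V U hU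
  rw [hs, conjTranspose_submatrix, submatrix_mul_equiv, submatrix_mul_equiv] at this
  exact this

lemma IsDensity_ptraceRight {a c : Type} [Fintype a] [Fintype c]
    {M : Matrix (a × c) (a × c) ℂ} (h : IsDensity M) : IsDensity (ptraceRight M) := by
  classical
  constructor
  · have : ptraceRight M = ∑ k : c, M.submatrix (fun i => (i, k)) (fun i => (i, k)) := by
      ext i j; simp [ptraceRight, Matrix.sum_apply]
    rw [this]
    exact Matrix.posSemidef_sum _ fun k _ => h.1.submatrix _
  · rw [← h.2]; simp [Matrix.trace, ptraceRight, Fintype.sum_prod_type]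

lemma IsDensity_ptraceLeft {a c : Type} [Fintype a] [Fintype c]
    {M : Matrix (a × c) (a × c) ℂ} (h : IsDensity M) : IsDensity (ptraceLeft M) := by
  rw [ptraceLeft_eq_swap]
  refine IsDensity_ptraceRight ⟨h.1.submatrix _, ?_⟩
  rw [← h.2]
  exact Fintype.sum_equiv (Equiv.prodComm c a) _ _ fun _ => rfl

/-- Equality in subadditivity forces a product state. -/
lemma subadd_eq {a c : Type} [Fintype a] [DecidableEq a] [Fintype c] [DecidableEq c]
    {σ : Matrix (a × c) (a × c) ℂ} (hσ : IsDensity σ)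
    (hS : vN σ = vN (ptraceRight σ) + vN (ptraceLeft σ)) :
    σ = ptraceRight σ ⊗ₖ ptraceLeft σ := by
  have hR := IsDensity_ptraceRight hσ
  have hL := IsDensity_ptraceLeft hσ
  obtain ⟨U, α, hU1, hU2, hα, hAU, htα, hvα⟩ := spec_exists hR.1
  obtain ⟨V, γ, hV1, hV2, hγ, hAV, htγ, hvγ⟩ := spec_exists hL.1
  have hα1 : ∑ i, α i = 1 := by
    have := hR.2; rw [htα] at this; exact_mod_cast this
  have hγ1 : ∑ i, γ i = 1 := by
    have := hL.2; rw [htγ] at this; exact_mod_cast this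
  set W := U ⊗ₖ V with hW
  have hW1 : W * Wᴴ = 1 := by
    rw [hW, conjTranspose_kronecker, ← mul_kronecker_mul, hU1, hV1, one_kronecker_one]
  have hW2 : Wᴴ * W = 1 := by
    rw [hW, conjTranspose_kronecker, ← mul_kronecker_mul, hU2, hV2, one_kronecker_one]
  set D := Wᴴ * σ * W with hD
  have hDpos : D.PosSemidef := hσ.1.conjTranspose_mul_mul_same W
  set d : a → c → ℝ := fun i j => (D (i, j) (i, j)).re with hd
  have hDd : ∀ i j, D (i, j) (i, j) = (d i j : ℂ) := fun i j =>
    (hDpos.isHermitian.coe_re_apply_self (i, j)).symm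
  have hdn : ∀ i j, 0 ≤ d i j := by
    intro i j
    have := hDpos.diag_nonneg (i := (i, j))
    rw [hDd] at this; exact_mod_cast this
  have hmR : ∀ i, ∑ j, d i j = α i := by
    intro i
    have h1 := ptraceRight_conj σ U V hV1
    have h2 : Uᴴ * ptraceRight σ * U = diagonal (fun i => (α i : ℂ)) := by
      rw [hAU]
      calc Uᴴ * (U * diagonal (fun i => (α i : ℂ)) * Uᴴ) * U
          = (Uᴴ * U) * diagonal (fun i => (α i : ℂ)) * (Uᴴ * U) := by simp only [Matrix.mul_assoc]
        _ = _ := by rw [hU2, Matrix.one_mul, Matrix.mul_one]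
    rw [h2] at h1
    have h3 := congrFun (congrFun h1 i) i
    rw [diagonal_apply_eq] at h3
    have h4 : ((∑ j, d i j : ℝ) : ℂ) = α i := by
      rw [← h3]; push_cast
      exact Finset.sum_congr rfl fun j _ => (hDd i j).symm
    exact_mod_cast h4
  have hmL : ∀ j, ∑ i, d i j = γ j := by
    intro j
    have h1 := ptraceLeft_conj σ U V hU1
    have h2 : Vᴴ * ptraceLeft σ * V = diagonal (fun i => (γ i : ℂ)) := by
      rw [hAV]
      calc Vᴴ * (V * diagonal (fun i => (γ i : ℂ)) * Vᴴ) * V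
          = (Vᴴ * V) * diagonal (fun i => (γ i : ℂ)) * (Vᴴ * V) := by simp only [Matrix.mul_assoc]
        _ = _ := by rw [hV2, Matrix.one_mul, Matrix.mul_one]
    rw [h2] at h1
    have h3 := congrFun (congrFun h1 j) j
    rw [diagonal_apply_eq] at h3
    have h4 : ((∑ i, d i j : ℝ) : ℂ) = γ j := by
      rw [← h3]; push_cast
      exact Finset.sum_congr rfl fun i _ => (hDd i j).symm
    exact_mod_cast h4
  have zR : ∀ i j, α i = 0 → d i j = 0 := fun i j h =>
    (Finset.sum_eq_zero_iff_of_nonneg (fun j _ => hdn i j)).1 ((hmR i).trans h) j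
      (Finset.mem_univ _)
  have zL : ∀ i j, γ j = 0 → d i j = 0 := fun i j h =>
    (Finset.sum_eq_zero_iff_of_nonneg (fun i _ => hdn i j)).1 ((hmL j).trans h) i
      (Finset.mem_univ _)
  have main := klein_eq hσ hW1 hW2 (fun p => α p.1 * γ p.2)
    (fun p => mul_nonneg (hα _) (hγ _))
    (by rw [Fintype.sum_prod_type]; simp_rw [← Finset.mul_sum, hγ1, mul_one, hα1])
    (by
      rintro ⟨i, j⟩ h
      rw [← hD, hDd]
      rcases mul_eq_zero.1 h with h | h
      · rw [zR i j h]; simp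
      · rw [zL i j h]; simp)
    (by
      rw [← hD, hS, hvα, hvγ, Fintype.sum_prod_type]
      have : ∀ i j, (D (i, j) (i, j)).re * Real.log (α i * γ j)
          = d i j * Real.log (α i) + d i j * Real.log (γ j) := by
        intro i j
        by_cases h1 : α i = 0
        · change d i j * _ = _
          rw [zR i j h1]; simp
        by_cases h2 : γ j = 0
        · change d i j * _ = _
          rw [zL i j h2]; simp
        rw [Real.log_mul h1 h2, mul_add]
      simp_rw [this, Finset.sum_add_distrib]
      rw [Finset.sum_comm (f := fun i j => d i j * Real.log (γ j))]
      simp_rw [← Finset.sum_mul, hmR, hmL]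
      ring)
  have hdiag : diagonal (fun p : a × c => ((α p.1 * γ p.2 : ℝ) : ℂ))
      = diagonal (fun i => (α i : ℂ)) ⊗ₖ diagonal (fun j => (γ j : ℂ)) := by
    rw [diagonal_kronecker_diagonal]; simp
  rw [hdiag, hW, conjTranspose_kronecker, ← mul_kronecker_mul, ← mul_kronecker_mul, ← hAU,
    ← hAV] at main
  exact main

open scoped MatrixOrder in
lemma psd_factor {n : Type} [Fintype n] [DecidableEq n] {A : Matrix n n ℂ} (h : A.PosSemidef) :
    ∃ R : Matrix n n ℂ, A = Rᴴ * R :=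
  CStarAlgebra.nonneg_iff_eq_star_mul_self.1 h.nonneg

/-- If `ρ_BC` saturates the Araki–Lieb inequality, then every component of any convex
decomposition of `ρ_BC` has the same marginal on `C`. -/
theorem arakiLieb_saturation_marginals {B C ι : Type} [Fintype B] [DecidableEq B]
    [Fintype C] [DecidableEq C] [Fintype ι]
    (ρ : Matrix (B × C) (B × C) ℂ) (hρ : IsDensity ρ)
    (hsat : vN ρ + vN (ptraceLeft ρ) - vN (ptraceRight ρ) = 0)
    (q : ι → ℝ) (ρi : ι → Matrix (B × C) (B × C) ℂ)
    (hq : ∀ i, 0 < q i) (hρi : ∀ i, IsDensity (ρi i))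
    (hdecomp : ρ = ∑ i, q i • ρi i) :
    ∀ i, ptraceLeft (ρi i) = ptraceLeft ρ := by
  classical
  have hex : ∀ i, ∃ R : Matrix (B × C) (B × C) ℂ, ρi i = Rᴴ * R := fun i =>
    psd_factor (hρi i).1
  choose R hR using hex
  have hRe : ∀ i x y, ∑ a, star (R i a x) * R i a y = ρi i x y := by
    intro i x y
    rw [hR i, Matrix.mul_apply]
    rfl
  have hsq : ∀ i, star ((Real.sqrt (q i) : ℂ)) * (Real.sqrt (q i) : ℂ) = (q i : ℂ) := by
    intro i
    rw [RCLike.star_def, Complex.conj_ofReal, ← Complex.ofReal_mul, Real.mul_self_sqrt (hq i).le]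
  -- the purification adapted to the decomposition
  let K : Matrix (ι × (B × C)) (B × C) ℂ := Matrix.of fun p x => (Real.sqrt (q p.1) : ℂ) * R p.1 p.2 x
  have hKi : ∀ i x y, ∑ a, star (K (i, a) x) * K (i, a) y = q i * ρi i x y := by
    intro i x y
    rw [← hRe i x y, Finset.mul_sum]
    refine Finset.sum_congr rfl fun a _ => ?_
    rw [← hsq i]
    simp only [K, of_apply, star_mul']
    ring
  have hKK : Kᴴ * K = ρ := by
    ext x y
    rw [Matrix.mul_apply, Fintype.sum_prod_type, hdecomp, Matrix.sum_apply]
    refine Finset.sum_congr rfl fun i _ => ?_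
    rw [Matrix.smul_apply, Complex.real_smul, ← hKi]
    rfl
  let Z : Matrix ((ι × (B × C)) × C) B ℂ := Matrix.of fun p b => K p.1 (b, p.2)
  have hZZ : Zᴴ * Z = ptraceRight ρ := by
    ext b b'
    rw [← hKK]
    simp only [ptraceRight, Matrix.mul_apply, of_apply, conjTranspose_apply, Z]
    rw [Fintype.sum_prod_type, Finset.sum_comm]
  set σ := Z * Zᴴ with hσ
  have hσe : ∀ p c p' c', σ (p, c) (p', c') = ∑ b, K p (b, c) * star (K p' (b, c')) := by
    intro p c p' c'
    rw [hσ, Matrix.mul_apply]; rfl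
  have hσA : ptraceRight σ = K * Kᴴ := by
    ext p p'
    simp only [ptraceRight, of_apply, hσe, Matrix.mul_apply, conjTranspose_apply]
    rw [Fintype.sum_prod_type, Finset.sum_comm]
  have hσC : ptraceLeft σ = (ptraceLeft ρ)ᵀ := by
    ext c c'
    rw [← hKK]
    simp only [ptraceLeft, of_apply, hσe, Matrix.mul_apply, conjTranspose_apply, transpose_apply]
    rw [Finset.sum_comm]
    refine Finset.sum_congr rfl fun b _ => Finset.sum_congr rfl fun p _ => ?_
    ring
  have hσd : IsDensity σ := by
    refine ⟨posSemidef_self_mul_conjTranspose Z, ?_⟩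
    rw [hσ, Matrix.trace_mul_comm, hZZ]
    exact (IsDensity_ptraceRight hρ).2
  have hS : vN σ = vN (ptraceRight σ) + vN (ptraceLeft σ) := by
    rw [hσA, hσC, vN_transpose (IsDensity_ptraceLeft hρ).1.isHermitian, vN_mul_comm K, hKK, hσ,
      vN_mul_comm Z, hZZ]
    linarith
  have hprod := subadd_eq hσd hS
  intro i
  ext c c'
  have e : ∀ a, σ ((i, a), c') ((i, a), c) = (∑ x, K (i, a) x * star (K (i, a) x)) *
      ptraceLeft ρ c c' := by
    intro a
    rw [hprod, kroneckerMap_apply, hσC, transpose_apply, hσA, Matrix.mul_apply]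
    rfl
  have e2 : ∑ a, σ ((i, a), c') ((i, a), c) = q i * ptraceLeft (ρi i) c c' := by
    simp only [hσe, ptraceLeft, of_apply, Finset.mul_sum, ← hKi]
    rw [Finset.sum_comm]
    refine Finset.sum_congr rfl fun b _ => Finset.sum_congr rfl fun p _ => ?_
    ring
  have e3 : ∑ a, ∑ x, K (i, a) x * star (K (i, a) x) = q i := by
    rw [Finset.sum_comm]
    have : ∀ x, ∑ a, K (i, a) x * star (K (i, a) x) = q i * ρi i x x := by
      intro x
      rw [← hKi]
      exact Finset.sum_congr rfl fun a _ => mul_comm _ _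
    simp_rw [this, ← Finset.mul_sum]
    have ht : ∑ x, ρi i x x = 1 := (hρi i).2
    rw [ht, mul_one]
  simp_rw [e, ← Finset.sum_mul, e3] at e2
  exact (mul_left_cancel₀ (Complex.ofReal_ne_zero.2 (hq i).ne') e2).symm
end

section
/- Two quantum Markov states with identical overlapping marginals coincide: if ρ_ABC and σ_ABC satisfy ρ_AB = σ_AB, ρ_BC = σ_BC, and I(A:C|B)_ρ = I(A:C|B)_σ = 0, then ρ_ABC = σ_ABC. -/
open Matrix Kronecker ComplexOrder

noncomputable def mAB {A B C : Type} [Fintype A] [Fintype B] [Fintype C]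
    (ρ : Matrix (A × B × C) (A × B × C) ℂ) : Matrix (A × B) (A × B) ℂ :=
  Matrix.of fun x y => ∑ c, ρ (x.1, x.2, c) (y.1, y.2, c)

noncomputable def mBC {A B C : Type} [Fintype A] [Fintype B] [Fintype C]
    (ρ : Matrix (A × B × C) (A × B × C) ℂ) : Matrix (B × C) (B × C) ℂ :=
  Matrix.of fun x y => ∑ a, ρ (a, x) (a, y)

noncomputable def mB {A B C : Type} [Fintype A] [Fintype B] [Fintype C]
    (ρ : Matrix (A × B × C) (A × B × C) ℂ) : Matrix B B ℂ :=
  Matrix.of fun x y => ∑ a, ∑ c, ρ (a, x, c) (a, y, c)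

set_option linter.unusedSectionVars false
set_option linter.unusedSimpArgs false

/-- `M = U diag(d) Uᴴ` with `U` unitary. -/
structure SpecDec {n : Type} [Fintype n] [DecidableEq n] (M U : Matrix n n ℂ) (d : n → ℝ) :
    Prop where
  left : Uᴴ * U = 1
  right : U * Uᴴ = 1
  eq : M = U * diagonal (fun i => (d i : ℂ)) * Uᴴ

section generic
variable {n : Type} [Fintype n] [DecidableEq n]

lemma specDec_of_hermitian {M : Matrix n n ℂ} (h : M.IsHermitian) :
    SpecDec M (h.eigenvectorUnitary : Matrix n n ℂ) h.eigenvalues := by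
  refine ⟨?_, ?_, ?_⟩
  · exact Unitary.coe_star_mul_self h.eigenvectorUnitary
  · exact Unitary.coe_mul_star_self h.eigenvectorUnitary
  · have := h.spectral_theorem
    rw [Unitary.conjStarAlgAut_apply] at this
    exact this

/-- overlap weights -/
noncomputable def ov (V U : Matrix n n ℂ) (i j : n) : ℝ := Complex.normSq ((Vᴴ * U) i j)

lemma ov_nonneg (V U : Matrix n n ℂ) (i j : n) : 0 ≤ ov V U i j := Complex.normSq_nonneg _

lemma diag_entry {M U V : Matrix n n ℂ} {p : n → ℝ} (hM : SpecDec M U p) (i : n) :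
    (Vᴴ * M * V) i i = ((∑ j, ov V U i j * p j : ℝ) : ℂ) := by
  have : Vᴴ * M * V = (Vᴴ * U) * diagonal (fun i => (p i : ℂ)) * (Vᴴ * U)ᴴ := by
    rw [hM.eq, conjTranspose_mul, conjTranspose_conjTranspose]; simp only [Matrix.mul_assoc]
  rw [this, Matrix.mul_apply]
  push_cast
  refine Finset.sum_congr rfl fun j _ => ?_
  rw [mul_diagonal, conjTranspose_apply, ov, ← Complex.mul_conj, Complex.star_def]
  ring

lemma ov_colsum {V U : Matrix n n ℂ} (hV : V * Vᴴ = 1) (hU : Uᴴ * U = 1) (j : n) :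
    ∑ i, ov V U i j = 1 := by
  have h : (Vᴴ * U)ᴴ * (Vᴴ * U) = 1 := by
    rw [conjTranspose_mul, conjTranspose_conjTranspose, Matrix.mul_assoc, ← Matrix.mul_assoc V,
      hV, Matrix.one_mul, hU]
  have h2 := congrFun (congrFun h j) j
  rw [Matrix.mul_apply, one_apply_eq] at h2
  have : ((∑ i, ov V U i j : ℝ) : ℂ) = 1 := by
    rw [← h2]; push_cast
    refine Finset.sum_congr rfl fun i _ => ?_
    rw [conjTranspose_apply, ov, ← Complex.mul_conj, Complex.star_def]; ring
  exact_mod_cast this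

lemma ov_rowsum {V U : Matrix n n ℂ} (hV : Vᴴ * V = 1) (hU : U * Uᴴ = 1) (i : n) :
    ∑ j, ov V U i j = 1 := by
  have h : (Vᴴ * U) * (Vᴴ * U)ᴴ = 1 := by
    rw [conjTranspose_mul, conjTranspose_conjTranspose, Matrix.mul_assoc, ← Matrix.mul_assoc U,
      hU, Matrix.one_mul, hV]
  have h2 := congrFun (congrFun h i) i
  rw [Matrix.mul_apply, one_apply_eq] at h2
  have : ((∑ j, ov V U i j : ℝ) : ℂ) = 1 := by
    rw [← h2]; push_cast
    refine Finset.sum_congr rfl fun j _ => ?_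
    rw [conjTranspose_apply, ov, ← Complex.mul_conj, Complex.star_def]
  exact_mod_cast this

lemma trace_mul_fun {M U V : Matrix n n ℂ} {p : n → ℝ} (hM : SpecDec M U p) (l : n → ℝ) :
    trace (M * (V * diagonal (fun i => (l i : ℂ)) * Vᴴ)) =
      ((∑ i, ∑ j, ov V U i j * p j * l i : ℝ) : ℂ) := by
  have : trace (M * (V * diagonal (fun i => (l i : ℂ)) * Vᴴ)) =
      trace ((Vᴴ * M * V) * diagonal (fun i => (l i : ℂ))) := by
    rw [← Matrix.mul_assoc, trace_mul_comm]; simp only [Matrix.mul_assoc]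
  rw [this, trace]
  simp only [diag_apply, mul_diagonal, diag_entry hM]
  push_cast
  simp only [Finset.sum_mul]

lemma trace_self_fun {M V : Matrix n n ℂ} {q : n → ℝ} (hM : SpecDec M V q) (l : n → ℝ) :
    trace (M * (V * diagonal (fun i => (l i : ℂ)) * Vᴴ)) = ((∑ i, q i * l i : ℝ) : ℂ) := by
  have : trace (M * (V * diagonal (fun i => (l i : ℂ)) * Vᴴ)) =
      trace ((Vᴴ * M * V) * diagonal (fun i => (l i : ℂ))) := by
    rw [← Matrix.mul_assoc, trace_mul_comm]; simp only [Matrix.mul_assoc]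
  have h2 : Vᴴ * M * V = diagonal (fun i => (q i : ℂ)) := by
    rw [hM.eq]
    calc _ = (Vᴴ * V) * diagonal (fun i => (q i : ℂ)) * (Vᴴ * V) := by
            simp only [Matrix.mul_assoc]
      _ = _ := by rw [hM.left]; simp
  rw [this, h2, diagonal_mul_diagonal, trace_diagonal]
  push_cast; rfl

/-- relative entropy in spectral form -/
noncomputable def relE (V U : Matrix n n ℂ) (q p : n → ℝ) : ℝ :=
  ∑ i, ∑ j, ov V U i j * p j * (Real.log (p j) - Real.log (q i))

lemma relE_eq {V U : Matrix n n ℂ} (hV : V * Vᴴ = 1) (hU : Uᴴ * U = 1) (q p : n → ℝ) :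
    relE V U q p = ∑ j, p j * Real.log (p j) - ∑ i, ∑ j, ov V U i j * p j * Real.log (q i) := by
  unfold relE
  simp only [mul_sub, Finset.sum_sub_distrib]
  congr 1
  rw [Finset.sum_comm]
  refine Finset.sum_congr rfl fun j _ => ?_
  simp only [mul_assoc]
  rw [← Finset.sum_mul, ov_colsum hV hU, one_mul]

/-- The variational functional. -/
noncomputable def Ff (t : ℝ) (ρ σ Y : Matrix n n ℂ) : ℝ :=
  (2 * trace (Yᴴ * ρ) - trace (Yᴴ * σ * Y) - t * trace (Y * ρ * Yᴴ)).re

lemma Ff_formula {ρ σ U V : Matrix n n ℂ} {p q : n → ℝ} (hρ : SpecDec ρ U p)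
    (hσ : SpecDec σ V q) (t : ℝ) (Z : Matrix n n ℂ) :
    Ff t ρ σ (V * Z * Uᴴ) = ∑ i, ∑ j, (2 * (star (Z i j) * (Vᴴ * U) i j).re * p j
      - (q i + t * p j) * Complex.normSq (Z i j)) := by
  have h1 : trace ((V * Z * Uᴴ)ᴴ * ρ) = ∑ i, ∑ j, star (Z i j) * (Vᴴ * U) i j * p j := by
    have : trace ((V * Z * Uᴴ)ᴴ * ρ) = trace (Zᴴ * (Vᴴ * U * diagonal (fun i => (p i : ℂ)))) := by
      rw [hρ.eq]
      calc _ = trace (U * (Zᴴ * Vᴴ * U * diagonal (fun i => (p i : ℂ)) * Uᴴ)) := by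
            simp only [conjTranspose_mul, conjTranspose_conjTranspose, Matrix.mul_assoc]
        _ = trace (Zᴴ * Vᴴ * U * diagonal (fun i => (p i : ℂ)) * (Uᴴ * U)) := by
            rw [trace_mul_comm]; simp only [Matrix.mul_assoc]
        _ = _ := by rw [hρ.left]; simp only [Matrix.mul_assoc, Matrix.mul_one]
    rw [this, trace, Finset.sum_comm]
    refine Finset.sum_congr rfl fun j _ => ?_
    rw [diag_apply, Matrix.mul_apply]
    refine Finset.sum_congr rfl fun i _ => ?_
    rw [mul_diagonal, conjTranspose_apply]; ring
  have h2 : trace ((V * Z * Uᴴ)ᴴ * σ * (V * Z * Uᴴ)) =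
      ∑ i, ∑ j, (q i * Complex.normSq (Z i j) : ℂ) := by
    have : trace ((V * Z * Uᴴ)ᴴ * σ * (V * Z * Uᴴ)) =
        trace (Zᴴ * (diagonal (fun i => (q i : ℂ)) * Z)) := by
      rw [hσ.eq]
      calc _ = trace (U * (Zᴴ * (Vᴴ * V) * diagonal (fun i => (q i : ℂ)) * (Vᴴ * V) * Z * Uᴴ)) := by
            simp only [conjTranspose_mul, conjTranspose_conjTranspose, Matrix.mul_assoc]
        _ = trace (Zᴴ * (Vᴴ * V) * diagonal (fun i => (q i : ℂ)) * (Vᴴ * V) * Z * (Uᴴ * U)) := by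
            rw [trace_mul_comm]; simp only [Matrix.mul_assoc]
        _ = _ := by rw [hρ.left, hσ.left]; simp only [Matrix.mul_assoc, Matrix.mul_one, Matrix.one_mul]
    rw [this, trace, Finset.sum_comm]
    refine Finset.sum_congr rfl fun j _ => ?_
    rw [diag_apply, Matrix.mul_apply]
    refine Finset.sum_congr rfl fun i _ => ?_
    rw [diagonal_mul, conjTranspose_apply, ← Complex.mul_conj, Complex.star_def]; ring
  have h3 : trace ((V * Z * Uᴴ) * ρ * (V * Z * Uᴴ)ᴴ) =
      ∑ i, ∑ j, (p j * Complex.normSq (Z i j) : ℂ) := by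
    have : trace ((V * Z * Uᴴ) * ρ * (V * Z * Uᴴ)ᴴ) =
        trace (Z * diagonal (fun i => (p i : ℂ)) * Zᴴ) := by
      rw [hρ.eq]
      calc _ = trace (V * (Z * (Uᴴ * U) * diagonal (fun i => (p i : ℂ)) * (Uᴴ * U) * Zᴴ * Vᴴ)) := by
            simp only [conjTranspose_mul, conjTranspose_conjTranspose, Matrix.mul_assoc]
        _ = trace (Z * (Uᴴ * U) * diagonal (fun i => (p i : ℂ)) * (Uᴴ * U) * Zᴴ * (Vᴴ * V)) := by
            rw [trace_mul_comm]; simp only [Matrix.mul_assoc]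
        _ = _ := by rw [hρ.left, hσ.left]; simp only [Matrix.mul_assoc, Matrix.mul_one, Matrix.one_mul]
    rw [this, trace]
    refine Finset.sum_congr rfl fun i _ => ?_
    rw [diag_apply, Matrix.mul_apply]
    refine Finset.sum_congr rfl fun j _ => ?_
    rw [mul_diagonal, conjTranspose_apply, ← Complex.mul_conj, Complex.star_def]; ring
  unfold Ff
  rw [h1, h2, h3]
  simp only [Finset.mul_sum, ← Finset.sum_sub_distrib, Complex.re_sum]
  refine Finset.sum_congr rfl fun i _ => Finset.sum_congr rfl fun j _ => ?_
  have e1 : ∀ z : ℂ, (2 * (z * (p j : ℂ))).re = 2 * z.re * p j := by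
    intro z; simp [Complex.mul_re]; ring
  rw [Complex.sub_re, Complex.sub_re, e1]
  have e2 : ((q i : ℂ) * (Complex.normSq (Z i j) : ℂ)).re = q i * Complex.normSq (Z i j) := by
    rw [← Complex.ofReal_mul, Complex.ofReal_re]
  have e3 : ((t : ℂ) * ((p j : ℂ) * (Complex.normSq (Z i j) : ℂ))).re
      = t * (p j * Complex.normSq (Z i j)) := by
    rw [← Complex.ofReal_mul, ← Complex.ofReal_mul, Complex.ofReal_re]
  rw [e2, e3]; ring

/-- value of the variational problem -/
noncomputable def Qv (V U : Matrix n n ℂ) (q p : n → ℝ) (t : ℝ) : ℝ :=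
  ∑ i, ∑ j, ov V U i j * p j * (p j / (q i + t * p j))

lemma Ff_le {ρ σ U V : Matrix n n ℂ} {p q : n → ℝ} (hρ : SpecDec ρ U p)
    (hσ : SpecDec σ V q) (hp : ∀ i, 0 ≤ p i) (hq : ∀ i, 0 ≤ q i) {t : ℝ} (ht : 0 < t)
    (Y : Matrix n n ℂ) : Ff t ρ σ Y ≤ Qv V U q p t := by
  have hY : Y = V * (Vᴴ * Y * U) * Uᴴ := by
    calc Y = (V * Vᴴ) * Y * (U * Uᴴ) := by rw [hσ.right, hρ.right]; simp
      _ = _ := by simp only [Matrix.mul_assoc]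
  rw [hY, Ff_formula hρ hσ]
  refine Finset.sum_le_sum fun i _ => Finset.sum_le_sum fun j _ => ?_
  generalize (Vᴴ * Y * U) i j = z
  unfold ov
  generalize (Vᴴ * U) i j = g
  rcases (hp j).eq_or_lt with h | h
  · rw [← h]
    have := mul_nonneg (hq i) (Complex.normSq_nonneg z)
    simp; linarith
  · have hd : 0 < q i + t * p j := by have := hq i; positivity
    set d := q i + t * p j
    rw [show Complex.normSq g * p j * (p j / d) = (Complex.normSq g * p j * p j) / d by ring,
      le_div_iff₀ hd]
    simp only [Complex.star_def, Complex.mul_re, Complex.conj_re, Complex.conj_im, Complex.normSq_apply]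
    nlinarith [sq_nonneg (g.re * p j - d * z.re), sq_nonneg (g.im * p j - d * z.im)]

lemma Ff_attained {ρ σ U V : Matrix n n ℂ} {p q : n → ℝ} (hρ : SpecDec ρ U p)
    (hσ : SpecDec σ V q) (hp : ∀ i, 0 ≤ p i) (hq : ∀ i, 0 ≤ q i) {t : ℝ} (ht : 0 < t) :
    ∃ Y, Ff t ρ σ Y = Qv V U q p t := by
  refine ⟨V * (Matrix.of fun i j => (Vᴴ * U) i j * ((p j / (q i + t * p j) : ℝ) : ℂ)) * Uᴴ, ?_⟩
  rw [Ff_formula hρ hσ]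
  refine Finset.sum_congr rfl fun i _ => Finset.sum_congr rfl fun j _ => ?_
  rw [of_apply]
  unfold ov
  generalize (Vᴴ * U) i j = g
  rcases (hp j).eq_or_lt with h | h
  · rw [← h]; simp
  · have hd : 0 < q i + t * p j := by have := hq i; positivity
    set d := q i + t * p j
    have : (star (g * ((p j / d : ℝ) : ℂ)) * g).re = Complex.normSq g * (p j / d) := by
      simp only [Complex.star_def, Complex.mul_re, Complex.mul_im, Complex.conj_re, Complex.conj_im,
        Complex.normSq_apply, Complex.ofReal_re, Complex.ofReal_im]
      ring
    rw [this, Complex.normSq_mul, Complex.normSq_ofReal]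
    field_simp
    ring

/-- primitive of `Qv` -/
noncomputable def Lv (V U : Matrix n n ℂ) (q p : n → ℝ) (t : ℝ) : ℝ :=
  ∑ i, ∑ j, ov V U i j * p j * Real.log (q i + t * p j)

lemma Lv_deriv (V U : Matrix n n ℂ) {q p : n → ℝ} (hp : ∀ i, 0 ≤ p i) (hq : ∀ i, 0 ≤ q i)
    {t : ℝ} (ht : 0 < t) : HasDerivAt (Lv V U q p) (Qv V U q p t) t := by
  unfold Lv Qv
  refine HasDerivAt.fun_sum fun i _ => HasDerivAt.fun_sum fun j _ => ?_
  rcases (hp j).eq_or_lt with h | h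
  · rw [← h]; simpa using hasDerivAt_const t (0 : ℝ)
  · have hd : 0 < q i + t * p j := by have := hq i; positivity
    refine HasDerivAt.const_mul _ ?_
    refine HasDerivAt.log ?_ hd.ne'
    simpa using ((hasDerivAt_id t).mul_const (p j)).const_add (q i)

lemma Lv_tendsto {V U : Matrix n n ℂ} (hV : V * Vᴴ = 1) (hU : Uᴴ * U = 1)
    {q p : n → ℝ} (hp : ∀ i, 0 ≤ p i) (hq : ∀ i, 0 ≤ q i)
    (hs : ∀ i j, q i = 0 → ov V U i j * p j = 0) (h1 : ∑ j, p j = 1) :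
    Filter.Tendsto (fun T => Lv V U q p T - Lv V U q p T⁻¹ - Real.log T) Filter.atTop
      (nhds (relE V U q p)) := by
  have e : ∀ T, Lv V U q p T - Lv V U q p T⁻¹ - Real.log T = ∑ i, ∑ j, ov V U i j * p j *
      (Real.log (q i + T * p j) - Real.log T - Real.log (q i + T⁻¹ * p j)) := by
    intro T
    have : ∑ i, ∑ j, ov V U i j * p j * Real.log T = Real.log T := by
      rw [Finset.sum_comm]
      simp only [mul_assoc]
      simp only [← Finset.sum_mul, ov_colsum hV hU, one_mul, h1]
    unfold Lv
    conv_lhs => rw [← this]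
    simp only [← Finset.sum_sub_distrib]
    refine Finset.sum_congr rfl fun i _ => Finset.sum_congr rfl fun j _ => ?_
    ring
  simp only [e]
  unfold relE
  refine tendsto_finsetSum _ fun i _ => tendsto_finsetSum _ fun j _ => ?_
  by_cases h0 : ov V U i j * p j = 0
  · simp only [h0, zero_mul]; exact tendsto_const_nhds
  have hpj : 0 < p j := lt_of_le_of_ne (hp j) fun h => h0 (by rw [← h, mul_zero])
  have hqi : 0 < q i := lt_of_le_of_ne (hq i) fun h => h0 (hs i j h.symm)
  refine Filter.Tendsto.const_mul _ (Filter.Tendsto.sub ?_ ?_)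
  · have : Filter.Tendsto (fun T : ℝ => Real.log (q i * T⁻¹ + p j)) Filter.atTop
        (nhds (Real.log (q i * 0 + p j))) := by
      refine Filter.Tendsto.log ?_ (by simpa using hpj.ne')
      exact (tendsto_inv_atTop_zero.const_mul _).add_const _
    rw [mul_zero, zero_add] at this
    refine this.congr' ?_
    filter_upwards [Filter.eventually_gt_atTop 0] with T hT
    rw [← Real.log_div (by positivity) hT.ne']
    congr 1
    field_simp
  · have : Filter.Tendsto (fun T : ℝ => Real.log (q i + T⁻¹ * p j)) Filter.atTop
        (nhds (Real.log (q i + 0 * p j))) := by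
      refine Filter.Tendsto.log ?_ (by simpa using hqi.ne')
      exact (tendsto_inv_atTop_zero.mul_const _).const_add _
    simpa using this

lemma klein_scalar {p q : ℝ} (hp : 0 ≤ p) (hq : 0 < q) :
    0 ≤ p * (Real.log p - Real.log q) - p + q ∧
    (p * (Real.log p - Real.log q) - p + q = 0 → p = q) := by
  rcases hp.eq_or_lt with h | h
  · subst h
    simp only [zero_mul, sub_zero, zero_add]
    exact ⟨hq.le, fun h => h.symm⟩
  · have e : Real.log p - Real.log q = - Real.log (q / p) := by
      rw [Real.log_div hq.ne' h.ne']; ring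
    have e2 : p * (q / p) = q := by field_simp
    constructor
    · have := Real.log_le_sub_one_of_pos (div_pos hq h)
      rw [e]; nlinarith
    · intro h0
      by_contra hne
      have hne' : q / p ≠ 1 := fun h1 => hne (by rw [h1] at e2; linarith)
      have := Real.log_lt_sub_one_of_pos (div_pos hq h) hne'
      rw [e] at h0; nlinarith

/-- Klein's inequality, with the equality case. -/
lemma klein {ρ σ U V : Matrix n n ℂ} {p q : n → ℝ} (hρ : SpecDec ρ U p)
    (hσ : SpecDec σ V q) (hp : ∀ i, 0 ≤ p i) (hq : ∀ i, 0 ≤ q i)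
    (hs : ∀ i j, q i = 0 → ov V U i j * p j = 0) (hpq : ∑ j, p j = ∑ j, q j) :
    0 ≤ relE V U q p ∧ (relE V U q p = 0 → ρ = σ) := by
  have e : relE V U q p = ∑ i, ∑ j, ov V U i j *
      (p j * (Real.log (p j) - Real.log (q i)) - p j + q i) := by
    have a1 : ∑ i, ∑ j, ov V U i j * p j = ∑ j, p j := by
      rw [Finset.sum_comm]
      simp only [← Finset.sum_mul, ov_colsum hσ.right hρ.left, one_mul]
    have a2 : ∑ i, ∑ j, ov V U i j * q i = ∑ j, q j := by
      simp only [← Finset.sum_mul, ov_rowsum hσ.left hρ.right, one_mul]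
    have : relE V U q p = relE V U q p - ∑ i, ∑ j, ov V U i j * p j
        + ∑ i, ∑ j, ov V U i j * q i := by rw [a1, a2, hpq]; ring
    rw [this]; unfold relE
    simp only [← Finset.sum_sub_distrib, ← Finset.sum_add_distrib]
    refine Finset.sum_congr rfl fun i _ => Finset.sum_congr rfl fun j _ => ?_
    ring
  have hnn : ∀ i j, 0 ≤ ov V U i j *
      (p j * (Real.log (p j) - Real.log (q i)) - p j + q i) := by
    intro i j
    rcases (hq i).eq_or_lt with h | h
    · have := hs i j h.symm
      have : ov V U i j * (p j * (Real.log (p j) - Real.log (q i)) - p j + q i) = 0 := by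
        rw [← h]; linear_combination (Real.log (p j) - Real.log 0 - 1) * this
      rw [this]
    · exact mul_nonneg (ov_nonneg _ _ _ _) (klein_scalar (hp j) h).1
  refine ⟨e ▸ Finset.sum_nonneg fun i _ => Finset.sum_nonneg fun j _ => hnn i j, fun h0 => ?_⟩
  rw [e, Finset.sum_eq_zero_iff_of_nonneg
    (fun i _ => Finset.sum_nonneg fun j _ => hnn i j)] at h0
  have key : ∀ i j, (Vᴴ * U) i j * p j = q i * (Vᴴ * U) i j := by
    intro i j
    have h1 := (Finset.sum_eq_zero_iff_of_nonneg (fun j _ => hnn i j)).1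
      (h0 i (Finset.mem_univ i)) j (Finset.mem_univ j)
    rcases (hq i).eq_or_lt with h | h
    · have := hs i j h.symm
      rw [← h]
      rcases mul_eq_zero.1 this with h2 | h2
      · rw [Complex.normSq_eq_zero.1 h2]; simp
      · rw [h2]; simp
    · rcases mul_eq_zero.1 h1 with h2 | h2
      · rw [Complex.normSq_eq_zero.1 h2]; simp
      · rw [(klein_scalar (hp j) h).2 h2]; ring
  have key2 : (Vᴴ * U) * diagonal (fun i => (p i : ℂ)) = diagonal (fun i => (q i : ℂ)) * (Vᴴ * U) := by
    ext i j; rw [mul_diagonal, diagonal_mul]; exact key i j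
  calc ρ = (V * Vᴴ) * ρ := by rw [hσ.right, Matrix.one_mul]
    _ = V * ((Vᴴ * U) * diagonal (fun i => (p i : ℂ))) * Uᴴ := by
      rw [hρ.eq]; simp only [Matrix.mul_assoc]
    _ = V * diagonal (fun i => (q i : ℂ)) * Vᴴ * (U * Uᴴ) := by
      rw [key2]; simp only [Matrix.mul_assoc]
    _ = σ := by rw [hρ.right, Matrix.mul_one, ← hσ.eq]

/-- Monotonicity of relative entropy from the resolvent inequality. -/
lemma relE_mono {m : Type} [Fintype m] [DecidableEq m] {ρ σ U V : Matrix n n ℂ} {p q : n → ℝ}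
    {ρ' σ' U' V' : Matrix m m ℂ} {p' q' : m → ℝ}
    (hρ : SpecDec ρ U p) (hσ : SpecDec σ V q) (hp : ∀ i, 0 ≤ p i) (hq : ∀ i, 0 ≤ q i)
    (hs : ∀ i j, q i = 0 → ov V U i j * p j = 0) (h1 : ∑ j, p j = 1)
    (hρ' : SpecDec ρ' U' p') (hσ' : SpecDec σ' V' q') (hp' : ∀ i, 0 ≤ p' i) (hq' : ∀ i, 0 ≤ q' i)
    (hs' : ∀ i j, q' i = 0 → ov V' U' i j * p' j = 0) (h1' : ∑ j, p' j = 1)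
    (Φ : Matrix m m ℂ → Matrix n n ℂ) (hΦ : ∀ t Y, Ff t ρ σ (Φ Y) = Ff t ρ' σ' Y) :
    relE V' U' q' p' ≤ relE V U q p := by
  have hQ : ∀ t : ℝ, 0 < t → Qv V' U' q' p' t ≤ Qv V U q p t := by
    intro t ht
    obtain ⟨Y, hY⟩ := Ff_attained hρ' hσ' hp' hq' ht
    rw [← hY, ← hΦ]
    exact Ff_le hρ hσ hp hq ht _
  have hder : ∀ t : ℝ, 0 < t → HasDerivAt (fun t => Lv V U q p t - Lv V' U' q' p' t)
      (Qv V U q p t - Qv V' U' q' p' t) t := fun t ht =>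
    (Lv_deriv V U hp hq ht).sub (Lv_deriv V' U' hp' hq' ht)
  have hmono : MonotoneOn (fun t => Lv V U q p t - Lv V' U' q' p' t) (Set.Ioi 0) := by
    refine monotoneOn_of_deriv_nonneg (convex_Ioi 0)
      (fun t ht => (hder t ht).continuousAt.continuousWithinAt)
      (fun t ht => ?_) (fun t ht => ?_)
    · rw [interior_Ioi] at ht
      exact (hder t ht).differentiableAt.differentiableWithinAt
    · rw [interior_Ioi] at ht
      rw [(hder t ht).deriv]; exact sub_nonneg.2 (hQ t ht)
  refine le_of_tendsto_of_tendsto (Lv_tendsto hσ'.right hρ'.left hp' hq' hs' h1')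
    (Lv_tendsto hσ.right hρ.left hp hq hs h1) ?_
  filter_upwards [Filter.eventually_ge_atTop 1] with T hT
  have hT0 : (0 : ℝ) < T := by linarith
  have := hmono (a := T⁻¹) (b := T) (inv_pos.2 hT0) hT0 ((inv_le_one_of_one_le₀ hT).trans hT)
  simp only at this
  linarith

end generic

section ext
variable {n m C : Type} [Fintype n] [DecidableEq n] [Fintype m] [DecidableEq m]
  [Fintype C] [DecidableEq C]

/-- `X ⊗ 1`, along an identification of the index set with a product. -/
noncomputable def extR (e : n ≃ m × C) (X : Matrix m m ℂ) : Matrix n n ℂ :=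
  (X ⊗ₖ (1 : Matrix C C ℂ)).submatrix e e

/-- partial trace over `C` -/
noncomputable def ptr (e : n ≃ m × C) (M : Matrix n n ℂ) : Matrix m m ℂ :=
  Matrix.of fun x y => ∑ c, M (e.symm (x, c)) (e.symm (y, c))

lemma extR_mul (e : n ≃ m × C) (X Y : Matrix m m ℂ) :
    extR e (X * Y) = extR e X * extR e Y := by
  unfold extR
  rw [submatrix_mul_equiv, ← mul_kronecker_mul, Matrix.one_mul]

lemma extR_one (e : n ≃ m × C) : extR e (1 : Matrix m m ℂ) = 1 := by
  unfold extR
  rw [one_kronecker_one, submatrix_one_equiv]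

lemma extR_conjTranspose (e : n ≃ m × C) (X : Matrix m m ℂ) :
    extR e Xᴴ = (extR e X)ᴴ := by
  unfold extR
  rw [conjTranspose_submatrix, conjTranspose_kronecker, conjTranspose_one]

lemma extR_diagonal (e : n ≃ m × C) (d : m → ℂ) :
    extR e (diagonal d) = diagonal (fun i => d (e i).1) := by
  unfold extR
  rw [← diagonal_one, diagonal_kronecker_diagonal, submatrix_diagonal_equiv]
  simp [Function.comp_def]

lemma trace_extR (e : n ≃ m × C) (M : Matrix n n ℂ) (X : Matrix m m ℂ) :
    trace (M * extR e X) = trace (ptr e M * X) := by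
  have : trace (M * extR e X) = ∑ x : m × C, ∑ y : m × C,
      M (e.symm x) (e.symm y) * (X y.1 x.1 * (1 : Matrix C C ℂ) y.2 x.2) := by
    rw [trace, ← e.symm.sum_comp]
    refine Finset.sum_congr rfl fun x _ => ?_
    rw [diag_apply, Matrix.mul_apply, ← e.symm.sum_comp]
    simp [extR, kroneckerMap_apply]
  rw [this]
  simp only [Fintype.sum_prod_type, Matrix.one_apply, mul_ite, mul_one, mul_zero,
    Finset.sum_ite_eq', Finset.mem_univ, if_true]
  simp only [trace, diag_apply, Matrix.mul_apply, ptr, of_apply, Finset.sum_mul]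
  refine Finset.sum_congr rfl fun i _ => ?_
  rw [Finset.sum_comm]

lemma SpecDec.extR (e : n ≃ m × C) {X V : Matrix m m ℂ} {q : m → ℝ} (h : SpecDec X V q) :
    SpecDec (extR e X) (extR e V) (fun i => q (e i).1) := by
  refine ⟨?_, ?_, ?_⟩
  · rw [← extR_conjTranspose, ← extR_mul, h.left, extR_one]
  · rw [← extR_conjTranspose, ← extR_mul, h.right, extR_one]
  · conv_lhs => rw [h.eq]
    rw [extR_mul, extR_mul, extR_conjTranspose, extR_diagonal]

lemma cross_sum (e : n ≃ m × C) {M U : Matrix n n ℂ} {V : Matrix m m ℂ} {p : n → ℝ} {q : m → ℝ}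
    (hM : SpecDec M U p) (hN : SpecDec (ptr e M) V q) (l : m → ℝ) :
    ∑ i, ∑ j, ov (_root_.extR e V) U i j * p j * l (e i).1 = ∑ i, q i * l i := by
  have h1 := trace_mul_fun (V := _root_.extR e V) hM (fun i => l (e i).1)
  have h2 := trace_self_fun hN l
  have h3 : (_root_.extR e V) * diagonal (fun i => (l (e i).1 : ℂ)) * (_root_.extR e V)ᴴ =
      _root_.extR e (V * diagonal (fun i => (l i : ℂ)) * Vᴴ) := by
    rw [extR_mul, extR_mul, extR_conjTranspose, extR_diagonal]
  rw [h3, trace_extR, h2] at h1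
  exact_mod_cast h1.symm

lemma relE_ext (e : n ≃ m × C) {M U : Matrix n n ℂ} {V : Matrix m m ℂ} {p : n → ℝ} {q : m → ℝ}
    (hM : SpecDec M U p) (hN : SpecDec (ptr e M) V q) :
    relE (_root_.extR e V) U (fun i => q (e i).1) p =
      ∑ j, p j * Real.log (p j) - ∑ i, q i * Real.log (q i) := by
  rw [relE_eq (hN.extR e).right hM.left, cross_sum e hM hN (fun i => Real.log (q i))]

lemma supp_ext (e : n ≃ m × C) {M U : Matrix n n ℂ} {V : Matrix m m ℂ} {p : n → ℝ} {q : m → ℝ}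
    (hM : SpecDec M U p) (hN : SpecDec (ptr e M) V q) (hp : ∀ i, 0 ≤ p i) (i j : n)
    (hi : q (e i).1 = 0) : ov (_root_.extR e V) U i j * p j = 0 := by
  have h := cross_sum e hM hN (fun k => if k = (e i).1 then 1 else 0)
  have h0 : ∑ k, q k * (if k = (e i).1 then 1 else 0) = 0 := by simp [hi]
  rw [h0] at h
  have hnn : ∀ a b, 0 ≤ ov (_root_.extR e V) U a b * p b * (if (e a).1 = (e i).1 then 1 else 0) := by
    intro a b
    refine mul_nonneg (mul_nonneg (ov_nonneg _ _ _ _) (hp b)) ?_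
    split_ifs <;> norm_num
  have h1 := (Finset.sum_eq_zero_iff_of_nonneg
    (fun a _ => Finset.sum_nonneg fun b _ => hnn a b)).1 h i (Finset.mem_univ i)
  have h2 := (Finset.sum_eq_zero_iff_of_nonneg (fun b _ => hnn i b)).1 h1 j (Finset.mem_univ j)
  simpa using h2

end ext

section main

lemma vN_eq {n : Type} [Fintype n] [DecidableEq n] {M : Matrix n n ℂ} (h : M.IsHermitian) :
    vN M = -∑ i, h.eigenvalues i * Real.log (h.eigenvalues i) := dif_pos h

lemma sum_eig {n : Type} [Fintype n] [DecidableEq n] {M : Matrix n n ℂ} (h : M.IsHermitian)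
    (h1 : M.trace = 1) : ∑ i, h.eigenvalues i = 1 := by
  have := h.trace_eq_sum_eigenvalues
  rw [h1] at this
  have h2 : ((∑ i, h.eigenvalues i : ℝ) : ℂ) = ((1 : ℝ) : ℂ) := by
    rw [Complex.ofReal_sum, Complex.ofReal_one]; exact this.symm
  exact Complex.ofReal_injective h2

lemma ptr_density {n m C : Type} [Fintype n] [DecidableEq n] [Fintype m] [DecidableEq m]
    [Fintype C] [DecidableEq C] (e : n ≃ m × C) {M : Matrix n n ℂ} (h : IsDensity M) :
    IsDensity (ptr e M) := by
  constructor
  · have : ptr e M = ∑ c, M.submatrix (fun x => e.symm (x, c)) (fun x => e.symm (x, c)) := by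
      ext x y
      simp [ptr, Matrix.sum_apply]
    rw [this]
    exact posSemidef_sum _ fun c _ => h.1.submatrix _
  · have := trace_extR e M 1
    rw [extR_one, Matrix.mul_one, Matrix.mul_one] at this
    rw [← this, h.2]

/-- Strict concavity of the von Neumann entropy (midpoint form). -/
lemma entropy_strict {n : Type} [Fintype n] [DecidableEq n] {ρ σ τ : Matrix n n ℂ}
    (hρ : IsDensity ρ) (hσ : IsDensity σ) (hτ : IsDensity τ) (h2 : ρ + σ = τ + τ)
    (h : vN τ + vN τ ≤ vN ρ + vN σ) : ρ = σ := by
  have dρ := specDec_of_hermitian hρ.1.1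
  have dσ := specDec_of_hermitian hσ.1.1
  have dτ := specDec_of_hermitian hτ.1.1
  rw [vN_eq hρ.1.1, vN_eq hσ.1.1, vN_eq hτ.1.1] at h
  have pρ := hρ.1.eigenvalues_nonneg
  have pσ := hσ.1.eigenvalues_nonneg
  have pτ := hτ.1.eigenvalues_nonneg
  have sρ := sum_eig hρ.1.1 hρ.2
  have sσ := sum_eig hσ.1.1 hσ.2
  have sτ := sum_eig hτ.1.1 hτ.2
  generalize hρ.1.1.eigenvalues = p at *
  generalize hσ.1.1.eigenvalues = s at *
  generalize hτ.1.1.eigenvalues = r at *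
  generalize (hρ.1.1.eigenvectorUnitary : Matrix n n ℂ) = U at *
  generalize (hσ.1.1.eigenvectorUnitary : Matrix n n ℂ) = W at *
  generalize (hτ.1.1.eigenvectorUnitary : Matrix n n ℂ) = V at *
  have key : ∀ l : n → ℝ, ∑ i, ∑ j, ov V U i j * p j * l i + ∑ i, ∑ j, ov V W i j * s j * l i =
      ∑ i, r i * l i + ∑ i, r i * l i := by
    intro l
    have e := congrArg (fun M => trace (M * (V * diagonal (fun i => (l i : ℂ)) * Vᴴ))) h2
    simp only [Matrix.add_mul, trace_add] at e
    rw [trace_mul_fun dρ, trace_mul_fun dσ, trace_self_fun dτ] at e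
    exact_mod_cast e
  have hnn : ∀ (X : Matrix n n ℂ) (x : n → ℝ), (∀ j, 0 ≤ x j) → ∀ k i j,
      0 ≤ ov V X i j * x j * (if i = k then 1 else 0) := by
    intro X x hx k i j
    refine mul_nonneg (mul_nonneg (ov_nonneg _ _ _ _) (hx j)) ?_
    split_ifs <;> norm_num
  have hnn2 : ∀ (X : Matrix n n ℂ) (x : n → ℝ), (∀ j, 0 ≤ x j) → ∀ k,
      0 ≤ ∑ i, ∑ j, ov V X i j * x j * (if i = k then 1 else 0) := fun X x hx k =>
    Finset.sum_nonneg fun i _ => Finset.sum_nonneg fun j _ => hnn X x hx k i j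
  have supp : ∀ (X : Matrix n n ℂ) (x : n → ℝ), (∀ j, 0 ≤ x j) → ∀ k,
      ∑ i, ∑ j, ov V X i j * x j * (if i = k then 1 else 0) = 0 → ∀ j, ov V X k j * x j = 0 := by
    intro X x hx k h j
    have h1 := (Finset.sum_eq_zero_iff_of_nonneg
      (fun a _ => Finset.sum_nonneg fun b _ => hnn X x hx k a b)).1 h k (Finset.mem_univ k)
    have h2 := (Finset.sum_eq_zero_iff_of_nonneg (fun b _ => hnn X x hx k k b)).1 h1 j
      (Finset.mem_univ j)
    simpa using h2
  have both : ∀ k, r k = 0 →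
      ∑ i, ∑ j, ov V U i j * p j * (if i = k then 1 else 0) = 0 ∧
      ∑ i, ∑ j, ov V W i j * s j * (if i = k then 1 else 0) = 0 := by
    intro k hk
    have e := key (fun i => if i = k then 1 else 0)
    have e0 : ∑ i, r i * (if i = k then 1 else 0) = 0 := by simp [hk]
    rw [e0] at e
    have a := hnn2 U p pρ k
    have b := hnn2 W s pσ k
    constructor <;> linarith
  have k1 := klein dρ dτ pρ pτ (fun i j hi => supp U p pρ i (both i hi).1 j) (by rw [sρ, sτ])
  have k2 := klein dσ dτ pσ pτ (fun i j hi => supp W s pσ i (both i hi).2 j) (by rw [sσ, sτ])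
  have r1 := relE_eq dτ.right dρ.left r p
  have r2 := relE_eq dτ.right dσ.left r s
  have e := key (fun i => Real.log (r i))
  have z1 := k1.2 (by linarith [k1.1, k2.1])
  have z2 := k2.2 (by linarith [k1.1, k2.1])
  rw [z1, z2]

variable {A B C : Type} [Fintype A] [DecidableEq A] [Fintype B] [DecidableEq B]
  [Fintype C] [DecidableEq C]

lemma ptr_mAB (τ : Matrix (A × B × C) (A × B × C) ℂ) :
    ptr (Equiv.prodAssoc A B C).symm τ = mAB τ := rfl

lemma ptr_mBC (τ : Matrix (A × B × C) (A × B × C) ℂ) :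
    ptr (Equiv.prodComm A (B × C)) τ = mBC τ := rfl

lemma ptr_mB (τ : Matrix (A × B × C) (A × B × C) ℂ) :
    ptr (Equiv.refl (B × C)) (mBC τ) = mB τ := by
  ext x y
  simp only [ptr, mBC, mB, of_apply, Equiv.refl_symm, Equiv.refl_apply]
  rw [Finset.sum_comm]

lemma ptr_mB_mAB (τ : Matrix (A × B × C) (A × B × C) ℂ) :
    ptr (Equiv.prodComm A (B × C)) (extR (Equiv.prodAssoc A B C).symm (mAB τ)) =
      extR (Equiv.refl (B × C)) (mB τ) := by
  ext x y
  simp [ptr, extR, mAB, mB, kroneckerMap_apply, Finset.sum_mul]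

lemma Ff_ext {n m K : Type} [Fintype n] [DecidableEq n] [Fintype m] [DecidableEq m]
    [Fintype K] [DecidableEq K] (e : n ≃ m × K) (ρ σ : Matrix n n ℂ) (t : ℝ) (Y : Matrix m m ℂ) :
    Ff t ρ σ (extR e Y) = Ff t (ptr e ρ) (ptr e σ) Y := by
  have h1 : trace ((extR e Y)ᴴ * ρ) = trace (Yᴴ * ptr e ρ) := by
    rw [← extR_conjTranspose, trace_mul_comm, trace_extR, trace_mul_comm]
  have h2 : trace ((extR e Y)ᴴ * σ * extR e Y) = trace (Yᴴ * ptr e σ * Y) := by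
    rw [← extR_conjTranspose, Matrix.mul_assoc, trace_mul_comm, Matrix.mul_assoc, ← extR_mul,
      trace_extR, ← Matrix.mul_assoc, trace_mul_comm, Matrix.mul_assoc]
  have h3 : trace (extR e Y * ρ * (extR e Y)ᴴ) = trace (Y * ptr e ρ * Yᴴ) := by
    rw [← extR_conjTranspose, Matrix.mul_assoc, trace_mul_comm, Matrix.mul_assoc, ← extR_mul,
      trace_extR, ← Matrix.mul_assoc, trace_mul_comm, Matrix.mul_assoc]
  unfold Ff
  rw [h1, h2, h3]

/-- Strong subadditivity. -/
lemma ssa {τ : Matrix (A × B × C) (A × B × C) ℂ} (hτ : IsDensity τ) :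
    vN τ + vN (mB τ) ≤ vN (mAB τ) + vN (mBC τ) := by
  have dAB : IsDensity (mAB τ) := ptr_density (Equiv.prodAssoc A B C).symm hτ
  have dBC : IsDensity (mBC τ) := ptr_density (Equiv.prodComm A (B × C)) hτ
  have dB : IsDensity (mB τ) := by
    have := ptr_density (Equiv.refl (B × C)) dBC
    rwa [ptr_mB] at this
  have sABC := specDec_of_hermitian hτ.1.1
  have sAB := specDec_of_hermitian dAB.1.1
  have sBC := specDec_of_hermitian dBC.1.1
  have sB := specDec_of_hermitian dB.1.1
  have sAB' : SpecDec (ptr (Equiv.prodAssoc A B C).symm τ) _ _ := sAB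
  have sB' : SpecDec (ptr (Equiv.refl (B × C)) (mBC τ)) (dB.1.1.eigenvectorUnitary : Matrix B B ℂ)
      dB.1.1.eigenvalues := (ptr_mB τ).symm ▸ sB
  rw [vN_eq hτ.1.1, vN_eq dAB.1.1, vN_eq dBC.1.1, vN_eq dB.1.1]
  have m := relE_mono sABC (sAB.extR (Equiv.prodAssoc A B C).symm) hτ.1.eigenvalues_nonneg
    (fun i => dAB.1.eigenvalues_nonneg _)
    (fun i j => supp_ext (Equiv.prodAssoc A B C).symm sABC sAB' hτ.1.eigenvalues_nonneg i j)
    (sum_eig hτ.1.1 hτ.2)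
    sBC (sB.extR (Equiv.refl (B × C))) dBC.1.eigenvalues_nonneg
    (fun i => dB.1.eigenvalues_nonneg _)
    (fun i j => supp_ext (Equiv.refl (B × C)) sBC sB' dBC.1.eigenvalues_nonneg i j)
    (sum_eig dBC.1.1 dBC.2)
    (extR (Equiv.prodComm A (B × C)))
    (fun t Y => by rw [Ff_ext, ptr_mB_mAB, ptr_mBC])
  rw [relE_ext (Equiv.prodAssoc A B C).symm sABC sAB', relE_ext (Equiv.refl (B × C)) sBC sB'] at m
  linarith

end main

/-- Two quantum Markov states with the same `AB` and `BC` marginals coincide. -/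
theorem markov_states_with_equal_marginals_coincide {A B C : Type} [Fintype A] [DecidableEq A]
    [Fintype B] [DecidableEq B] [Fintype C] [DecidableEq C]
    (ρ σ : Matrix (A × B × C) (A × B × C) ℂ) (hρ : IsDensity ρ) (hσ : IsDensity σ)
    (hAB : mAB ρ = mAB σ) (hBC : mBC ρ = mBC σ)
    (hρMarkov : vN (mAB ρ) + vN (mBC ρ) - vN (mB ρ) - vN ρ = 0)
    (hσMarkov : vN (mAB σ) + vN (mBC σ) - vN (mB σ) - vN σ = 0) :
    ρ = σ := by
  have hB : mB ρ = mB σ := by rw [← ptr_mB, ← ptr_mB, hBC]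
  set τ : Matrix (A × B × C) (A × B × C) ℂ := (1 / 2 : ℂ) • (ρ + σ) with hτdef
  have h2 : ρ + σ = τ + τ := by
    rw [hτdef, ← add_smul]; norm_num
  have hτ : IsDensity τ := by
    refine ⟨(hρ.1.add hσ.1).smul ?_, ?_⟩
    · rw [show (1 / 2 : ℂ) = ((1 / 2 : ℝ) : ℂ) by norm_num]
      exact Complex.zero_le_real.2 (by norm_num)
    · rw [hτdef, trace_smul, trace_add, hρ.2, hσ.2]; norm_num
  have tBC : mBC τ = mBC ρ := by
    have : mBC τ = (1 / 2 : ℂ) • (mBC ρ + mBC σ) := by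
      ext x y
      simp [mBC, hτdef, Finset.mul_sum, Finset.sum_add_distrib, mul_add]
    rw [this, ← hBC, ← two_smul ℂ, smul_smul]; norm_num
  have tAB : mAB τ = mAB ρ := by
    have : mAB τ = (1 / 2 : ℂ) • (mAB ρ + mAB σ) := by
      ext x y
      simp [mAB, hτdef, Finset.mul_sum, Finset.sum_add_distrib, mul_add]
    rw [this, ← hAB, ← two_smul ℂ, smul_smul]; norm_num
  have tB : mB τ = mB ρ := by rw [← ptr_mB, ← ptr_mB, tBC]
  have hs := ssa hτ
  rw [tAB, tBC, tB] at hs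
  rw [← hAB, ← hBC, ← hB] at hσMarkov
  exact entropy_strict hρ hσ hτ h2 (by linarith)
end
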